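/- Let n, c, d, p be nonnegative integers with p ≤ n, c ≥ d, and d ≥ 1 if p ≥ 1. Then, as an identity of rational functions in x_1,…,x_n, sp_{2n}((c^n); x^{±1}) · sp_{2n}((d^{n−p},(d−1)^p); x^{±1}) = Σ_ν sp_{2n}(ν; x^{±1}), where ν ranges over all partitions with ((c−d)^n) ⊆ ν ⊆ ((c+d)^n) such that exactly p of the numbers ν_1−(c−d), …, ν_n−(c−d) are odd. -/

import Mathlib

open scoped Classical
open Finset

noncomputable section

/-- The field of rational functions in `n` variables over `ℚ`. -/
abbrev FF (n : ℕ) : Type := FractionRing (MvPolynomial (Fin n) ℚ)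

/-- The variables, as elements of the rational function field. -/
def Xv (n : ℕ) : Fin n → FF n := fun i =>
  algebraMap (MvPolynomial (Fin n) ℚ) (FF n) (MvPolynomial.X i)

/-- Irreducible symplectic character `sp_{2n}(λ; x^{±1})` via the Weyl character formula. -/
def spWeyl {F : Type} [Field F] (n : ℕ) (lam : Fin n → ℤ) (x : Fin n → F) : F :=
  Matrix.det (Matrix.of fun i j : Fin n =>
    x j ^ (lam i + (n : ℤ) - ((i : ℕ) : ℤ)) - x j ^ (-(lam i + (n : ℤ) - ((i : ℕ) : ℤ)))) /
  Matrix.det (Matrix.of fun i j : Fin n =>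
    x j ^ ((n : ℤ) - ((i : ℕ) : ℤ)) - x j ^ (-((n : ℤ) - ((i : ℕ) : ℤ))))


/-- number of elements of `M` below `k`. -/
def cntLt (M : Finset ℕ) (k : ℕ) : ℕ := (M.filter (fun a => a < k)).card

/-- number of elements of `L` whose associated part is odd. -/
def oddN (L : Finset ℕ) : ℕ := (L.filter (fun a => Odd (a + cntLt L a))).card

/-- auxiliary count used for telescoping. -/
def auxD (M : Finset ℕ) (k : ℕ) : ℕ :=
  (M.filter (fun a => a < k ∧ Odd (a + cntLt M a))).card +
  (M.filter (fun a => k ≤ a ∧ ¬ Odd (a + cntLt M a))).card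

theorem cntLt_insert (M : Finset ℕ) (k a : ℕ) (hk : k ∉ M) :
    cntLt (insert k M) a = cntLt M a + if k < a then 1 else 0 := by
  unfold cntLt
  rw [Finset.filter_insert]
  split_ifs with h
  · rw [Finset.card_insert_of_notMem (by simp [hk])]
  · simp

theorem oddN_insert (M : Finset ℕ) (k : ℕ) (hk : k ∉ M) :
    oddN (insert k M) = auxD M k + if Odd (k + cntLt M k) then 1 else 0 := by
  have h1 : M.filter (fun a => Odd (a + cntLt (insert k M) a)) =
      (M.filter (fun a => a < k ∧ Odd (a + cntLt M a))) ∪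
      (M.filter (fun a => k ≤ a ∧ ¬ Odd (a + cntLt M a))) := by
    ext a
    simp only [Finset.mem_filter, Finset.mem_union]
    constructor
    · rintro ⟨ha, h⟩
      rw [cntLt_insert M k a hk] at h
      split_ifs at h with h2
      · right; refine ⟨ha, h2.le, ?_⟩
        rw [← add_assoc] at h; grind
      · left; refine ⟨ha, ?_, h⟩
        rcases lt_or_eq_of_le (not_lt.1 h2) with h3 | h3
        · exact h3
        · exact absurd (h3 ▸ ha) hk
    · rintro (⟨ha, h2, h⟩ | ⟨ha, h2, h⟩)
      · refine ⟨ha, ?_⟩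
        rw [cntLt_insert M k a hk, if_neg (by omega)]; exact h
      · refine ⟨ha, ?_⟩
        have : k < a := lt_of_le_of_ne h2 (fun e => hk (e ▸ ha))
        rw [cntLt_insert M k a hk, if_pos this]; grind
  have h2 : (M.filter (fun a => Odd (a + cntLt (insert k M) a))).card = auxD M k := by
    rw [h1, auxD, Finset.card_union_of_disjoint]
    rw [Finset.disjoint_filter]
    intro a _ h h'
    exact h'.2 h.2
  unfold oddN
  rw [Finset.filter_insert]
  have h3 : cntLt (insert k M) k = cntLt M k := by
    rw [cntLt_insert M k k hk]; simp
  rw [h3]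
  split_ifs with h
  · rw [Finset.card_insert_of_notMem (by simp [hk]), h2]
  · rw [h2]; rfl

theorem cntLt_succ (M : Finset ℕ) (k : ℕ) :
    cntLt M (k + 1) = cntLt M k + if k ∈ M then 1 else 0 := by
  unfold cntLt
  split_ifs with h
  · have : M.filter (fun a => a < k + 1) = insert k (M.filter (fun a => a < k)) := by
      ext a; simp only [Finset.mem_filter, Finset.mem_insert]
      constructor
      · rintro ⟨h1, h2⟩
        by_cases e : a = k
        · exact Or.inl e
        · exact Or.inr ⟨h1, by omega⟩
      · rintro (rfl | ⟨h1, h2⟩)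
        · exact ⟨h, by omega⟩
        · exact ⟨h1, by omega⟩
    rw [this, Finset.card_insert_of_notMem (by simp)]
  · congr 1
    ext a; simp only [Finset.mem_filter]
    constructor
    · rintro ⟨h1, h2⟩
      exact ⟨h1, lt_of_le_of_ne (by omega) (fun e => h (e ▸ h1))⟩
    · rintro ⟨h1, h2⟩
      exact ⟨h1, by omega⟩

theorem auxD_eq_sum (M : Finset ℕ) (k : ℕ) :
    auxD M k = ∑ a ∈ M, if a < k then (if Odd (a + cntLt M a) then 1 else 0)
      else (if Odd (a + cntLt M a) then 0 else 1) := by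
  unfold auxD
  rw [Finset.card_filter, Finset.card_filter, ← Finset.sum_add_distrib]
  apply Finset.sum_congr rfl
  intro a _
  by_cases h1 : a < k <;> by_cases h2 : Odd (a + cntLt M a) <;> simp [h1, h2]

theorem auxD_succ_notMem (M : Finset ℕ) (k : ℕ) (hk : k ∉ M) :
    auxD M (k + 1) = auxD M k := by
  rw [auxD_eq_sum, auxD_eq_sum]
  apply Finset.sum_congr rfl
  intro a ha
  have : a ≠ k := fun e => hk (e ▸ ha)
  have h : a < k + 1 ↔ a < k := by omega
  simp [h]

theorem auxD_succ_mem (M : Finset ℕ) (k : ℕ) (hk : k ∈ M) :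
    auxD M (k + 1) + (if Odd (k + cntLt M k) then 0 else 1)
      = auxD M k + (if Odd (k + cntLt M k) then 1 else 0) := by
  rw [auxD_eq_sum, auxD_eq_sum, ← Finset.add_sum_erase M _ hk, ← Finset.add_sum_erase M _ hk]
  have : ∀ a ∈ M.erase k, (a < k + 1 ↔ a < k) := by
    intro a ha
    have := (Finset.mem_erase.1 ha).1
    omega
  have h2 : ∑ a ∈ M.erase k, (if a < k + 1 then (if Odd (a + cntLt M a) then 1 else 0)
      else (if Odd (a + cntLt M a) then 0 else 1)) =
      ∑ a ∈ M.erase k, (if a < k then (if Odd (a + cntLt M a) then 1 else 0)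
      else (if Odd (a + cntLt M a) then 0 else 1)) :=
    Finset.sum_congr rfl (fun a ha => by simp only [this a ha])
  rw [h2]
  simp
  omega

theorem auxD_ends (M : Finset ℕ) (N : ℕ) (hM : ∀ a ∈ M, a < N) :
    auxD M 0 + auxD M N = M.card := by
  rw [auxD_eq_sum, auxD_eq_sum, ← Finset.sum_add_distrib, Finset.card_eq_sum_ones]
  apply Finset.sum_congr rfl
  intro a ha
  simp [hM a ha]
  split_ifs <;> rfl

theorem tele {F : Type} [Field F] (y : F) (M : Finset ℕ) (d N : ℕ)
    (hM : ∀ a ∈ M, a < N) (hN : N = 2 * d + M.card + 1) :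
    ∑ k ∈ (Finset.range N).filter (fun k => k ∉ M),
      (-1 : F) ^ (cntLt M k + oddN (insert k M)) *
        (y ^ ((d : ℤ) + oddN (insert k M) + k) - y ^ (-((d : ℤ) + oddN (insert k M)) + k)) = 0 := by
  let U : ℕ → F := fun k =>
    if Odd (k + cntLt M k) then
      - ((-1 : F) ^ (cntLt M k + auxD M k) * y ^ ((k : ℤ) - 1 - auxD M k - d))
    else - ((-1 : F) ^ (cntLt M k + auxD M k) * y ^ ((auxD M k : ℤ) + k + d))
  have key : ∀ k, (if k ∉ M then (-1 : F) ^ (cntLt M k + oddN (insert k M)) *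
        (y ^ ((d : ℤ) + oddN (insert k M) + k) - y ^ (-((d : ℤ) + oddN (insert k M)) + k)) else 0)
        = U (k + 1) - U k := by
    intro k
    by_cases hk : k ∈ M
    · have h1 := auxD_succ_mem M k hk
      have h2 : cntLt M (k + 1) = cntLt M k + 1 := by rw [cntLt_succ, if_pos hk]
      simp only [hk, not_true_eq_false, if_false, U, h2]
      by_cases ho : Odd (k + cntLt M k)
      · have ho' : Odd (k + 1 + (cntLt M k + 1)) := by grind
        simp only [ho, if_true] at h1
        have h1 : auxD M (k + 1) = auxD M k + 1 := by omega
        rw [if_pos ho, if_pos ho', h1]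
        have : ((k + 1 : ℕ) : ℤ) - 1 - (auxD M k + 1 : ℕ) - d = (k : ℤ) - 1 - auxD M k - d := by
          push_cast; ring
        rw [this]; ring
      · have ho' : ¬ Odd (k + 1 + (cntLt M k + 1)) := by grind
        simp only [ho, if_false] at h1
        have h1 : auxD M k = auxD M (k + 1) + 1 := by omega
        rw [if_neg ho, if_neg ho', h1]
        have : ((auxD M (k+1) : ℕ) : ℤ) + (k + 1 : ℕ) + d = (auxD M (k+1) + 1 : ℕ) + k + d := by
          push_cast; ring
        rw [this]; ring
    · have h1 := auxD_succ_notMem M k hk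
      have h2 : cntLt M (k + 1) = cntLt M k := by rw [cntLt_succ, if_neg hk]; rfl
      simp only [hk, not_false_eq_true, if_true, U, h2, h1, oddN_insert M k hk]
      by_cases ho : Odd (k + cntLt M k)
      · have ho' : ¬ Odd (k + 1 + cntLt M k) := by grind
        rw [if_pos ho, if_neg ho', if_pos ho]
        have e1 : (d : ℤ) + (auxD M k + 1 : ℕ) + k = (auxD M k : ℤ) + (k + 1 : ℕ) + d := by
          push_cast; ring
        have e2 : -((d : ℤ) + (auxD M k + 1 : ℕ)) + k = (k : ℤ) - 1 - auxD M k - d := by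
          push_cast; ring
        rw [e1, e2]; ring
      · have ho' : Odd (k + 1 + cntLt M k) := by grind
        rw [if_neg ho, if_pos ho', if_neg ho]
        have e1 : (d : ℤ) + (auxD M k + 0 : ℕ) + k = (auxD M k : ℤ) + k + d := by
          push_cast; ring
        have e2 : -((d : ℤ) + (auxD M k + 0 : ℕ)) + k = ((k + 1 : ℕ) : ℤ) - 1 - auxD M k - d := by
          push_cast; ring
        rw [e1, e2]; ring
  rw [Finset.sum_filter, Finset.sum_congr rfl (fun k _ => key k), Finset.sum_range_sub]
  have hcN : cntLt M N = M.card := by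
    unfold cntLt
    rw [Finset.filter_true_of_mem hM]
  have hc0 : cntLt M 0 = 0 := by simp [cntLt]
  have hD := auxD_ends M N hM
  have hoN : Odd (N + cntLt M N) := by rw [hcN, hN]; grind
  have ho0 : ¬ Odd (0 + cntLt M 0) := by rw [hc0]; simp
  simp only [U]
  rw [if_pos hoN, if_neg ho0, hcN, hc0]
  have e1 : (N : ℤ) - 1 - auxD M N - d = (auxD M 0 : ℤ) + (0 : ℕ) + d := by
    push_cast; omega
  have e2 : (-1 : F) ^ (M.card + auxD M N) = (-1) ^ (0 + auxD M 0) := by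
    rw [← hD]
    have : auxD M 0 + auxD M N + auxD M N = (0 + auxD M 0) + 2 * auxD M N := by ring
    rw [this, pow_add _ (0 + auxD M 0), pow_mul]; simp
  rw [e1, e2]; ring

/-- strictly decreasing sequences of length `n` with entries below `N`. -/
def SS (n N : ℕ) : Finset (Fin n → ℕ) :=
  (Fintype.piFinset fun _ : Fin n => Finset.range N).filter (fun l => StrictAnti l)

/-- image of a sequence. -/
def img {n : ℕ} (l : Fin n → ℕ) : Finset ℕ := Finset.univ.image l

theorem mem_SS {n N : ℕ} {l : Fin n → ℕ} : l ∈ SS n N ↔ (∀ i, l i < N) ∧ StrictAnti l := by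
  simp [SS]

theorem mem_img {n : ℕ} {l : Fin n → ℕ} {k : ℕ} : k ∈ img l ↔ ∃ i, l i = k := by
  simp [img]

theorem strictAnti_unique {n : ℕ} {l l' : Fin n → ℕ} (h : StrictAnti l) (h' : StrictAnti l')
    (e : img l = img l') : l = l' := by
  have h1 : StrictMono (l ∘ Fin.rev) := h.comp Fin.rev_strictAnti
  have h1' : StrictMono (l' ∘ Fin.rev) := h'.comp Fin.rev_strictAnti
  have : l ∘ Fin.rev = l' ∘ Fin.rev := by
    apply (StrictMono.range_inj h1 h1').1
    have hr : ∀ f : Fin n → ℕ, Set.range (f ∘ Fin.rev) = Set.range f := fun f =>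
      Fin.rev_surjective.range_comp f
    rw [hr, hr]
    ext k
    have := Finset.ext_iff.1 e k
    rw [mem_img, mem_img] at this
    exact this
  funext i
  have := congrFun this (Fin.rev i)
  simpa using this

theorem cntLt_img {n : ℕ} {l : Fin n → ℕ} (h : StrictAnti l) (i : Fin n) :
    cntLt (img l) (l i) = n - 1 - i := by
  unfold cntLt img
  rw [Finset.filter_image, Finset.card_image_of_injective _ h.injective, ← Fin.card_Ioi]
  congr 1
  ext a
  simp [h.lt_iff_gt]

theorem oddN_img {n : ℕ} {l : Fin n → ℕ} (h : StrictAnti l) :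
    oddN (img l) = (Finset.univ.filter (fun i : Fin n => Odd (l i + (n - 1 - i)))).card := by
  have : (img l).filter (fun a => Odd (a + cntLt (img l) a)) =
      (Finset.univ.filter (fun i : Fin n => Odd (l i + (n - 1 - i)))).image l := by
    conv_lhs => rw [img, Finset.filter_image]
    congr 1
    ext i
    simp only [Finset.mem_filter, Finset.mem_univ, true_and]
    rw [show Finset.image l Finset.univ = img l from rfl, cntLt_img h]
  unfold oddN
  rw [this, Finset.card_image_of_injective _ h.injective]

theorem img_succAbove {n : ℕ} {l : Fin (n + 1) → ℕ} (i : Fin (n + 1)) :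
    img l = insert (l i) (img (l ∘ i.succAbove)) := by
  ext k
  rw [Finset.mem_insert, mem_img, mem_img]
  constructor
  · rintro ⟨a, rfl⟩
    rcases Fin.eq_self_or_eq_succAbove i a with rfl | ⟨b, rfl⟩
    · exact Or.inl rfl
    · exact Or.inr ⟨b, rfl⟩
  · rintro (rfl | ⟨b, rfl⟩)
    · exact ⟨i, rfl⟩
    · exact ⟨_, rfl⟩

theorem notMem_img_succAbove {n : ℕ} {l : Fin (n + 1) → ℕ} (h : StrictAnti l) (i : Fin (n + 1)) :
    l i ∉ img (l ∘ i.succAbove) := by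
  rw [mem_img]
  rintro ⟨b, hb⟩
  exact Fin.succAbove_ne i b (h.injective hb)

theorem exists_strictAnti (n : ℕ) (T : Finset ℕ) (hT : T.card = n) :
    ∃ l : Fin n → ℕ, StrictAnti l ∧ img l = T := by
  refine ⟨T.orderEmbOfFin hT ∘ Fin.rev, (T.orderEmbOfFin hT).strictMono.comp_strictAnti
    Fin.rev_strictAnti, ?_⟩
  ext k
  rw [mem_img]
  have h2 := Finset.range_orderEmbOfFin T hT
  have h3 : k ∈ T ↔ k ∈ Set.range (T.orderEmbOfFin hT) := by rw [h2]; simp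
  rw [h3]
  constructor
  · rintro ⟨i, rfl⟩; exact ⟨_, rfl⟩
  · rintro ⟨i, rfl⟩; exact ⟨Fin.rev i, by simp⟩

theorem sum_reindex {F : Type} [Field F] (n N : ℕ) (Φ : Finset ℕ → ℕ → F)
    (Ψ : (Fin n → ℕ) → F) :
    ∑ l ∈ SS (n + 1) N, ∑ i : Fin (n + 1),
        (-1 : F) ^ (i : ℕ) * Φ (img l) (l i) * Ψ (l ∘ i.succAbove)
      = ∑ m ∈ SS n N, ∑ k ∈ (Finset.range N).filter (fun k => k ∉ img m),
        (-1 : F) ^ (n + cntLt (img m) k) * Φ (insert k (img m)) k * Ψ m := by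
  rw [Finset.sum_sigma', Finset.sum_sigma']
  refine Finset.sum_bij (fun a _ => ⟨a.1 ∘ a.2.succAbove, a.1 a.2⟩) ?_ ?_ ?_ ?_
  · rintro ⟨l, i⟩ h
    simp only [Finset.mem_sigma, Finset.mem_filter, Finset.mem_range, mem_SS, Finset.mem_univ,
      and_true] at h ⊢
    exact ⟨⟨fun a => h.1 _, h.2.comp_strictMono (Fin.strictMono_succAbove i)⟩, h.1 i,
      notMem_img_succAbove h.2 i⟩
  · rintro ⟨l, i⟩ h ⟨l', i'⟩ h' e
    simp only [Finset.mem_sigma, mem_SS, Finset.mem_univ, and_true] at h h'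
    simp only [Sigma.mk.injEq, heq_eq_eq] at e
    have hl : l = l' := by
      apply strictAnti_unique h.2 h'.2
      rw [img_succAbove i, img_succAbove (l := l') i', e.1, e.2]
    subst hl
    have := h.2.injective e.2
    subst this
    rfl
  · rintro ⟨m, k⟩ h
    simp only [Finset.mem_sigma, Finset.mem_filter, Finset.mem_range, mem_SS] at h
    obtain ⟨⟨h1, h2⟩, h3, h4⟩ := h
    have hc : (img m).card = n := by
      rw [img, Finset.card_image_of_injective _ h2.injective]; simp
    obtain ⟨l, hl, hl2⟩ := exists_strictAnti (n + 1) (insert k (img m))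
      (by rw [Finset.card_insert_of_notMem h4, hc])
    obtain ⟨i, hi⟩ := mem_img.1 (show k ∈ img l by rw [hl2]; simp)
    refine ⟨⟨l, i⟩, ?_, ?_⟩
    · simp only [Finset.mem_sigma, mem_SS, Finset.mem_univ, and_true]
      refine ⟨fun a => ?_, hl⟩
      have : l a ∈ img l := mem_img.2 ⟨a, rfl⟩
      rw [hl2, Finset.mem_insert, mem_img] at this
      rcases this with h | ⟨b, hb⟩
      · omega
      · rw [← hb]; exact h1 b
    · have : l ∘ i.succAbove = m := by
        apply strictAnti_unique (hl.comp_strictMono (Fin.strictMono_succAbove i)) h2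
        have e := img_succAbove (l := l) i
        have e2 := notMem_img_succAbove hl i
        rw [hl2] at e
        rw [hi] at e e2
        rw [← Finset.erase_insert h4, e, Finset.erase_insert e2]
      simp only [this, hi]
  · rintro ⟨l, i⟩ h
    simp only [Finset.mem_sigma, mem_SS, Finset.mem_univ, and_true] at h
    have h1 := img_succAbove (l := l) i
    have h2 := notMem_img_succAbove h.2 i
    have h3 := cntLt_img h.2 i
    rw [h1, cntLt_insert _ _ _ h2] at h3
    simp only [lt_irrefl, if_false] at h3
    simp only
    rw [← h1]
    congr 2
    have h4 : n + cntLt (img (l ∘ i.succAbove)) (l i) = i + 2 * (n - i) := by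
      have := i.2
      omega
    rw [h4, pow_add, pow_mul]; simp

/-- the column relation. -/
theorem column_rel {F : Type} [Field F] (n d : ℕ) (C : ℤ) (x : Fin n → F) (j : Fin n)
    (hx : ∀ j, x j ≠ 0) :
    ∑ l ∈ SS n (2 * d + n), (-1 : F) ^ (oddN (img l)) *
      (x j ^ ((d : ℤ) + oddN (img l)) - x j ^ (-((d : ℤ) + oddN (img l)))) *
      Matrix.det (Matrix.of fun i j : Fin n =>
        x j ^ ((l i : ℤ) + C) - x j ^ (-((l i : ℤ) + C))) = 0 := by
  obtain _ | n := n
  · exact j.elim0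
  have hexp : ∀ l ∈ SS (n + 1) (2 * d + (n + 1)), (-1 : F) ^ (oddN (img l)) *
      (x j ^ ((d : ℤ) + oddN (img l)) - x j ^ (-((d : ℤ) + oddN (img l)))) *
      Matrix.det (Matrix.of fun i j : Fin (n + 1) =>
        x j ^ ((l i : ℤ) + C) - x j ^ (-((l i : ℤ) + C))) =
      ∑ i : Fin (n + 1), (-1 : F) ^ (i : ℕ) *
        ((fun (L : Finset ℕ) (k : ℕ) => (-1 : F) ^ (oddN L) *
      (x j ^ ((d : ℤ) + oddN L) - x j ^ (-((d : ℤ) + oddN L))) *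
        (x j ^ ((k : ℤ) + C) - x j ^ (-((k : ℤ) + C)))) (img l) (l i)) *
      ((fun m : Fin n → ℕ => (-1 : F) ^ (j : ℕ) * Matrix.det (Matrix.of fun a b : Fin n =>
        x (j.succAbove b) ^ ((m a : ℤ) + C) - x (j.succAbove b) ^ (-((m a : ℤ) + C))))
        (l ∘ i.succAbove)) := by
    intro l _
    rw [Matrix.det_succ_column _ j, Finset.mul_sum]
    apply Finset.sum_congr rfl
    intro i _
    have : (Matrix.of fun i j : Fin (n + 1) =>
        x j ^ ((l i : ℤ) + C) - x j ^ (-((l i : ℤ) + C))).submatrix i.succAbove j.succAbove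
        = Matrix.of fun a b : Fin n => x (j.succAbove b) ^ (((l ∘ i.succAbove) a : ℤ) + C)
          - x (j.succAbove b) ^ (-(((l ∘ i.succAbove) a : ℤ) + C)) := rfl
    rw [this]
    simp only [Matrix.of_apply, pow_add]
    ring
  rw [Finset.sum_congr rfl hexp]
  refine (sum_reindex n _ (fun (L : Finset ℕ) (k : ℕ) => (-1 : F) ^ (oddN L) *
      (x j ^ ((d : ℤ) + oddN L) - x j ^ (-((d : ℤ) + oddN L))) *
        (x j ^ ((k : ℤ) + C) - x j ^ (-((k : ℤ) + C))))
      (fun m : Fin n → ℕ => (-1 : F) ^ (j : ℕ) * Matrix.det (Matrix.of fun a b : Fin n =>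
        x (j.succAbove b) ^ ((m a : ℤ) + C) - x (j.succAbove b) ^ (-((m a : ℤ) + C))))).trans ?_
  apply Finset.sum_eq_zero
  intro m hm
  rw [mem_SS] at hm
  rw [← Finset.sum_mul]
  have hc : (img m).card = n := by
    rw [img, Finset.card_image_of_injective _ hm.2.injective]; simp
  have hM : ∀ a ∈ img m, a < 2 * d + (n + 1) := by
    intro a ha
    obtain ⟨i, rfl⟩ := mem_img.1 ha
    exact hm.1 i
  have t1 := tele (x j) (img m) d (2 * d + (n + 1)) hM (by omega)
  have t2 := tele (x j)⁻¹ (img m) d (2 * d + (n + 1)) hM (by omega)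
  have : ∀ k ∈ (Finset.range (2 * d + (n + 1))).filter (fun k => k ∉ img m),
      (-1 : F) ^ (n + cntLt (img m) k) * ((-1 : F) ^ (oddN (insert k (img m))) *
      (x j ^ ((d : ℤ) + oddN (insert k (img m))) - x j ^ (-((d : ℤ) + oddN (insert k (img m))))) *
        (x j ^ ((k : ℤ) + C) - x j ^ (-((k : ℤ) + C)))) =
      ((-1 : F) ^ n * x j ^ C) * ((-1 : F) ^ (cntLt (img m) k + oddN (insert k (img m))) *
        (x j ^ ((d : ℤ) + oddN (insert k (img m)) + k)
          - x j ^ (-((d : ℤ) + oddN (insert k (img m))) + k))) +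
      ((-1 : F) ^ n * x j ^ (-C)) * ((-1 : F) ^ (cntLt (img m) k + oddN (insert k (img m))) *
        ((x j)⁻¹ ^ ((d : ℤ) + oddN (insert k (img m)) + k)
          - (x j)⁻¹ ^ (-((d : ℤ) + oddN (insert k (img m))) + k))) := by
    intro k _
    generalize (d : ℤ) + oddN (insert k (img m)) = D
    simp only [inv_zpow', neg_add, zpow_add₀ (hx j), pow_add, neg_neg]
    ring
  rw [Finset.sum_congr rfl this, Finset.sum_add_distrib, ← Finset.mul_sum, ← Finset.mul_sum, t1, t2]
  simp

theorem cramer_aux {F : Type} [Field F] (n : ℕ) (g : Fin (n + 1) → F)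
    (b : Fin (n + 1) → Fin n → F)
    (h : ∀ j, ∑ r : Fin (n + 1), (-1 : F) ^ (r : ℕ) * g r * b r j = 0) (r s : Fin (n + 1)) :
    g r * Matrix.det (Matrix.of fun i j => b (s.succAbove i) j) =
      g s * Matrix.det (Matrix.of fun i j => b (r.succAbove i) j) := by
  by_cases hg : g = 0
  · simp [hg]
  let z : Fin (n + 1) → F := fun k =>
    (if k = r then (-1) ^ (s : ℕ) * g s else 0) - (if k = s then (-1) ^ (r : ℕ) * g r else 0)
  let A : Matrix (Fin (n + 1)) (Fin (n + 1)) F := Matrix.of fun k =>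
    (Fin.cons (z k) (b k) : Fin (n + 1) → F)
  have hdet : A.det = 0 := by
    rw [← Matrix.exists_vecMul_eq_zero_iff]
    refine ⟨fun k => (-1 : F) ^ (k : ℕ) * g k, ?_, ?_⟩
    · intro h0
      apply hg
      funext k
      have := congrFun h0 k
      simpa using this
    · funext j
      refine Fin.cases ?_ (fun j => ?_) j
      · simp only [Matrix.vecMul, dotProduct, A, Matrix.of_apply, Fin.cons_zero, z, mul_sub,
          Finset.sum_sub_distrib, mul_ite, mul_zero, Finset.sum_ite_eq', Finset.mem_univ, if_true,
          Pi.zero_apply]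
        ring
      · simp only [Matrix.vecMul, dotProduct, A, Matrix.of_apply, Fin.cons_succ, Pi.zero_apply]
        exact h j
  rw [Matrix.det_succ_column_zero] at hdet
  have hsub : ∀ k : Fin (n + 1), A.submatrix k.succAbove Fin.succ =
      Matrix.of fun i j => b (k.succAbove i) j := by
    intro k; ext i j; simp [A]
  simp only [hsub] at hdet
  simp only [A, Matrix.of_apply, Fin.cons_zero, z, mul_sub, sub_mul,
          Finset.sum_sub_distrib, mul_ite, ite_mul, mul_zero, zero_mul,
          Finset.sum_ite_eq', Finset.mem_univ, if_true] at hdet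
  have h1 : ((-1 : F) ^ (r : ℕ)) * (-1) ^ (s : ℕ) ≠ 0 := by simp
  apply mul_left_cancel₀ h1
  linear_combination -hdet

/-- numerator of the Weyl formula. -/
def spNum {F : Type} [Field F] (n : ℕ) (lam : Fin n → ℤ) (x : Fin n → F) : F :=
  Matrix.det (Matrix.of fun i j : Fin n =>
    x j ^ (lam i + (n : ℤ) - ((i : ℕ) : ℤ)) - x j ^ (-(lam i + (n : ℤ) - ((i : ℕ) : ℤ))))

theorem spWeyl_eq {F : Type} [Field F] (n : ℕ) (lam : Fin n → ℤ) (x : Fin n → F) :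
    spWeyl n lam x = spNum n lam x / spNum n (fun _ => 0) x := by
  simp only [spWeyl, spNum, zero_add]

/-- the index set. -/
def VV (n c d p : ℕ) : Finset (Fin n → ℕ) :=
  ((Fintype.piFinset fun _ : Fin n => Finset.range (c + d + 1)).filter
            (fun ν => Antitone ν ∧ (∀ i, c - d ≤ ν i) ∧
              (Finset.univ.filter
                (fun i : Fin n => Odd ((ν i : ℤ) - ((c : ℤ) - (d : ℤ))))).card = p))

theorem mem_VV {n c d p : ℕ} {ν : Fin n → ℕ} : ν ∈ VV n c d p ↔
    (∀ i, ν i ≤ c + d) ∧ Antitone ν ∧ (∀ i, c - d ≤ ν i) ∧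
              (Finset.univ.filter
                (fun i : Fin n => Odd ((ν i : ℤ) - ((c : ℤ) - (d : ℤ))))).card = p := by
  simp [VV, Nat.lt_succ_iff]

theorem strictAnti_gap {n : ℕ} {l : Fin n → ℕ} (h : StrictAnti l) (t : ℕ) :
    ∀ i j : Fin n, (j : ℕ) = i + t → l j + t ≤ l i := by
  induction t with
  | zero => intro i j e; have : j = i := Fin.ext e; subst this; simp
  | succ t ih =>
    intro i j e
    have hj := j.2
    have h1 := ih i ⟨i + t, by omega⟩ rfl
    have h2 : l j < l ⟨i + t, by omega⟩ := h (by rw [Fin.lt_def]; simp; omega)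
    omega

theorem sum_SS_eq {F : Type} [Field F] (n c d p : ℕ) (hdc : d ≤ c) (x : Fin n → F) :
    ∑ l ∈ (SS n (2 * d + n)).filter (fun l => oddN (img l) = p),
      Matrix.det (Matrix.of fun i j : Fin n =>
        x j ^ ((l i : ℤ) + ((c : ℤ) - d + 1)) - x j ^ (-((l i : ℤ) + ((c : ℤ) - d + 1)))) =
    ∑ ν ∈ VV n c d p, spNum n (fun i => (ν i : ℤ)) x := by
  have lower : ∀ l ∈ SS n (2 * d + n), ∀ i : Fin n, n - 1 - i ≤ l i := by
    intro l hl i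
    have hi := i.2
    have := strictAnti_gap (mem_SS.1 hl).2 (n - 1 - i) i ⟨n - 1, by omega⟩ (by simp; omega)
    omega
  have upper : ∀ l ∈ SS n (2 * d + n), ∀ i : Fin n, l i ≤ 2 * d + (n - 1 - i) := by
    intro l hl i
    have hi := i.2
    have := strictAnti_gap (mem_SS.1 hl).2 i ⟨0, by omega⟩ i (by simp)
    have := (mem_SS.1 hl).1 ⟨0, by omega⟩
    omega
  refine Finset.sum_bij' (fun l _ => fun i => l i - (n - 1 - i) + (c - d))
    (fun ν _ => fun i => ν i - (c - d) + (n - 1 - i)) ?_ ?_ ?_ ?_ ?_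
  · intro l hl
    rw [Finset.mem_filter] at hl
    have lo := lower l hl.1
    have up := upper l hl.1
    have hs := (mem_SS.1 hl.1).2
    rw [mem_VV]
    refine ⟨fun i => ?_, ?_, fun i => by omega, ?_⟩
    · have := lo i; have := up i; omega
    · intro i j hij
      have h1 := strictAnti_gap hs (j - i) i j (by have := Fin.le_def.1 hij; omega)
      have := lo i; have := lo j
      have := j.2
      have := Fin.le_def.1 hij
      simp only
      omega
    · rw [← hl.2, oddN_img hs]
      congr 1
      ext i
      simp only [Finset.mem_filter, Finset.mem_univ, true_and]
      have := lo i
      rw [← Int.odd_coe_nat (l i + (n - 1 - i)), Int.odd_iff, Int.odd_iff]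
      omega
  · intro ν hν
    rw [mem_VV] at hν
    obtain ⟨h1, h2, h3, h4⟩ := hν
    have hs : StrictAnti (fun i : Fin n => ν i - (c - d) + (n - 1 - i)) := by
      intro i j hij
      have := h2 hij.le
      have := Fin.lt_def.1 hij
      have := h3 j
      have := j.2
      simp only
      omega
    rw [Finset.mem_filter, mem_SS]
    refine ⟨⟨fun i => ?_, hs⟩, ?_⟩
    · have := h1 i; have := i.2; omega
    · rw [← h4, oddN_img hs]
      congr 1
      ext i
      simp only [Finset.mem_filter, Finset.mem_univ, true_and]
      have := h3 i
      rw [← Int.odd_coe_nat, Int.odd_iff, Int.odd_iff]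
      omega
  · intro l hl
    rw [Finset.mem_filter] at hl
    funext i
    have := lower l hl.1 i
    simp only
    omega
  · intro ν hν
    rw [mem_VV] at hν
    funext i
    have := hν.2.2.1 i
    simp only
    omega
  · intro l hl
    rw [Finset.mem_filter] at hl
    unfold spNum
    congr 1
    ext i j
    have := lower l hl.1 i
    have hi := i.2
    have e : (l i : ℤ) + ((c : ℤ) - d + 1) = ((l i - (n - 1 - i) + (c - d) : ℕ) : ℤ) + n - i := by
      omega
    simp only [Matrix.of_apply]
    rw [e]

theorem oddN_le (L : Finset ℕ) : oddN L ≤ L.card := Finset.card_filter_le _ _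

/-- sum of numerators. -/
def GG {F : Type} [Field F] (n c d p : ℕ) (x : Fin n → F) : F :=
  ∑ ν ∈ VV n c d p, spNum n (fun i => (ν i : ℤ)) x

theorem GG_rel {F : Type} [Field F] (n c d : ℕ) (hdc : d ≤ c) (x : Fin n → F)
    (hx : ∀ j, x j ≠ 0) (j : Fin n) :
    ∑ p ∈ Finset.range (n + 1), (-1 : F) ^ p *
      (x j ^ ((d : ℤ) + p) - x j ^ (-((d : ℤ) + p))) * GG n c d p x = 0 := by
  rw [← column_rel n d ((c : ℤ) - d + 1) x j hx]
  have hmap : ∀ l ∈ SS n (2 * d + n), oddN (img l) ∈ Finset.range (n + 1) := by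
    intro l hl
    rw [Finset.mem_range, Nat.lt_succ_iff]
    refine (oddN_le _).trans (Finset.card_image_le.trans ?_)
    simp
  rw [← Finset.sum_fiberwise_of_maps_to hmap]
  apply Finset.sum_congr rfl
  intro p _
  rw [GG, ← sum_SS_eq n c d p hdc x, Finset.mul_sum]
  apply Finset.sum_congr rfl
  intro l hl
  rw [(Finset.mem_filter.1 hl).2]

theorem GG_cramer {F : Type} [Field F] (n c d p : ℕ) (hdc : d ≤ c) (hp : p ≤ n) (x : Fin n → F)
    (hx : ∀ j, x j ≠ 0) :
    GG n c d p x * spNum n (fun _ => (d : ℤ) - 1) x =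
      GG n c d n x *
        spNum n (fun i : Fin n => if (i : ℕ) < n - p then (d : ℤ) else (d : ℤ) - 1) x := by
  have h := cramer_aux n (fun r : Fin (n + 1) => GG n c d (n - r) x)
    (fun r j => x j ^ ((d : ℤ) + n - (r : ℕ)) - x j ^ (-((d : ℤ) + n - (r : ℕ)))) (by
      intro j
      have h := GG_rel n c d hdc x hx j
      rw [← Finset.sum_range_reflect, Finset.sum_range] at h
      rw [← mul_zero ((-1 : F) ^ n), ← h, Finset.mul_sum]
      apply Finset.sum_congr rfl
      intro r _
      have hr := r.2
      have e : n + 1 - 1 - (r : ℕ) = n - r := by omega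
      rw [e]
      have e2 : (d : ℤ) + (n - r : ℕ) = (d : ℤ) + n - (r : ℕ) := by omega
      rw [e2]
      have e3 : (-1 : F) ^ n * (-1) ^ (n - (r : ℕ)) = (-1) ^ (r : ℕ) := by
        rw [← pow_add]
        have : n + (n - (r : ℕ)) = r + 2 * (n - r) := by omega
        rw [this, pow_add, pow_mul]; simp
      rw [← e3]; ring) ⟨n - p, by omega⟩ 0
  have e1 : n - (n - p) = p := by omega
  simp only [e1, Fin.val_zero, Nat.sub_zero] at h
  have a1 : spNum n (fun _ => (d : ℤ) - 1) x = Matrix.det (Matrix.of fun i j : Fin n =>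
      x j ^ ((d : ℤ) + n - (((0 : Fin (n + 1)).succAbove i : Fin (n + 1)) : ℕ)) -
      x j ^ (-((d : ℤ) + n - (((0 : Fin (n + 1)).succAbove i : Fin (n + 1)) : ℕ)))) := by
    unfold spNum
    congr 1
    ext i j
    have e : (d : ℤ) - 1 + n - (i : ℕ) =
      (d : ℤ) + n - (((0 : Fin (n + 1)).succAbove i : Fin (n + 1)) : ℕ) := by
      simp; ring
    simp only [Matrix.of_apply]
    rw [e]
  have a2 : spNum n (fun i : Fin n => if (i : ℕ) < n - p then (d : ℤ) else (d : ℤ) - 1) x =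
      Matrix.det (Matrix.of fun i j : Fin n =>
      x j ^ ((d : ℤ) + n - (((⟨n - p, by omega⟩ : Fin (n + 1)).succAbove i : Fin (n + 1)) : ℕ)) -
      x j ^ (-((d : ℤ) + n -
        (((⟨n - p, by omega⟩ : Fin (n + 1)).succAbove i : Fin (n + 1)) : ℕ)))) := by
    unfold spNum
    congr 1
    ext i j
    have e : (if (i : ℕ) < n - p then (d : ℤ) else (d : ℤ) - 1) + n - (i : ℕ) =
      (d : ℤ) + n - (((⟨n - p, by omega⟩ : Fin (n + 1)).succAbove i : Fin (n + 1)) : ℕ) := by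
      unfold Fin.succAbove
      simp only [Fin.lt_def, Fin.val_castSucc]
      split_ifs <;> simp
      ring
    simp only [Matrix.of_apply]
    rw [e]
  rw [a1, a2]
  exact h

theorem VV_top (n c d : ℕ) (hdc : d + 1 ≤ c) : VV n c (d + 1) n = VV n c d 0 := by
  ext ν
  rw [mem_VV, mem_VV]
  have hall : (Finset.univ.filter
      (fun i : Fin n => Odd ((ν i : ℤ) - ((c : ℤ) - ((d + 1 : ℕ) : ℤ))))).card = n ↔
      ∀ i, Odd ((ν i : ℤ) - ((c : ℤ) - ((d + 1 : ℕ) : ℤ))) := by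
    have := Finset.card_filter_eq_iff (s := (Finset.univ : Finset (Fin n)))
      (p := fun i : Fin n => Odd ((ν i : ℤ) - ((c : ℤ) - ((d + 1 : ℕ) : ℤ))))
    rw [Finset.card_univ, Fintype.card_fin] at this
    simpa using this
  have hnone : (Finset.univ.filter
      (fun i : Fin n => Odd ((ν i : ℤ) - ((c : ℤ) - (d : ℤ))))).card = 0 ↔
      ∀ i, ¬ Odd ((ν i : ℤ) - ((c : ℤ) - (d : ℤ))) := by
    rw [Finset.card_eq_zero, Finset.filter_eq_empty_iff]; simp
  rw [hall, hnone]
  simp only [Int.odd_iff]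
  constructor
  · rintro ⟨h1, h2, h3, h4⟩
    refine ⟨fun i => ?_, h2, fun i => ?_, fun i => ?_⟩ <;>
    · have := h1 i; have := h3 i; have := h4 i; omega
  · rintro ⟨h1, h2, h3, h4⟩
    refine ⟨fun i => ?_, h2, fun i => ?_, fun i => ?_⟩ <;>
    · have := h1 i; have := h3 i; have := h4 i; omega

theorem VV_bot (n c : ℕ) : VV n c 0 0 = {fun _ => c} := by
  ext ν
  rw [mem_VV, Finset.mem_singleton]
  constructor
  · rintro ⟨h1, _, h3, _⟩
    funext i
    have := h1 i; have := h3 i; omega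
  · rintro rfl
    exact ⟨fun _ => by simp, antitone_const, fun _ => by simp, by simp⟩

theorem main_num {F : Type} [Field F] (n c : ℕ) (x : Fin n → F) (hx : ∀ j, x j ≠ 0)
    (hne : ∀ e : ℕ, spNum n (fun _ => (e : ℤ)) x ≠ 0) (d : ℕ) :
    ∀ p : ℕ, d ≤ c → p ≤ n → (1 ≤ p → 1 ≤ d) →
    GG n c d p x * spNum n (fun _ => 0) x = spNum n (fun _ => (c : ℤ)) x *
      spNum n (fun i : Fin n => if (i : ℕ) < n - p then (d : ℤ) else (d : ℤ) - 1) x := by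
  induction d with
  | zero =>
    intro p _ _ h
    have hp : p = 0 := by by_contra h0; have := h (by omega); omega
    subst hp
    simp [GG, VV_bot]
  | succ d ih =>
    intro p hdc hp _
    have h1 := GG_cramer n c (d + 1) p hdc hp x hx
    have h2 := ih 0 (by omega) (by omega) (by simp)
    have h3 : GG n c (d + 1) n x = GG n c d 0 x := by
      unfold GG; rw [VV_top n c d hdc]
    have e : (((d + 1 : ℕ) : ℤ) - 1) = d := by push_cast; ring
    simp only [Nat.sub_zero, Fin.is_lt, if_true] at h2
    rw [h3] at h1
    simp only [e] at h1 ⊢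
    apply mul_right_cancel₀ (hne d)
    linear_combination (spNum n (fun _ => 0) x) * h1 + (spNum n (fun i : Fin n =>
      if (i : ℕ) < n - p then ((d + 1 : ℕ) : ℤ) else (d : ℤ)) x) * h2

theorem coeff_prod_aux (n : ℕ) (a b : Fin n → ℕ) (s : Fin n →₀ ℕ) (hb : ∀ i, s i ≠ b i) :
    MvPolynomial.coeff s (∏ i : Fin n, ((MvPolynomial.X i : MvPolynomial (Fin n) ℚ) ^ a i
      - MvPolynomial.X i ^ b i)) = if ∀ i, a i = s i then 1 else 0 := by
  have h1 : ∀ i : Fin n, ((MvPolynomial.X i : MvPolynomial (Fin n) ℚ) ^ a i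
      - MvPolynomial.X i ^ b i) = ∑ β : Bool, MvPolynomial.monomial
        (Finsupp.single i (if β then a i else b i)) (if β then (1 : ℚ) else -1) := by
    intro i
    rw [Fintype.sum_bool, MvPolynomial.X_pow_eq_monomial, MvPolynomial.X_pow_eq_monomial]
    simp [sub_eq_add_neg]
  rw [Finset.prod_congr rfl (fun i _ => h1 i), Finset.prod_univ_sum, MvPolynomial.coeff_sum]
  have h2 : ∀ t : Fin n → Bool, (∏ i, MvPolynomial.monomial
        (Finsupp.single i (if t i then a i else b i)) (if t i then (1 : ℚ) else -1)) =
      MvPolynomial.monomial (∑ i, Finsupp.single i (if t i then a i else b i))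
        (∏ i, (if t i then (1 : ℚ) else -1)) := by
    intro t
    rw [MvPolynomial.monomial_sum_prod]
  have h3 : ∀ t : Fin n → Bool, (∑ i, Finsupp.single i (if t i then a i else b i)) = s ↔
      ∀ i, (if t i then a i else b i) = s i := by
    intro t
    rw [Finsupp.ext_iff]
    simp [Finsupp.finsetSum_apply, Finsupp.single_apply]
  rw [Finset.sum_eq_single (fun _ => true)]
  · rw [h2, MvPolynomial.coeff_monomial]
    have h4 := h3 (fun _ => true)
    simp only [if_true] at h4 ⊢
    simp only [h4, Finset.prod_const_one]
  · intro t _ ht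
    rw [h2, MvPolynomial.coeff_monomial, if_neg]
    rw [h3]
    intro hh
    apply ht
    funext i
    by_contra h
    have := hh i
    rw [if_neg h] at this
    exact hb i this.symm
  · intro h; simp at h

theorem poly_det_ne (n E : ℕ) (hE : n ≤ E) :
    Matrix.det (Matrix.of fun i j : Fin n => (MvPolynomial.X j : MvPolynomial (Fin n) ℚ)
      ^ (2 * E - i) - MvPolynomial.X j ^ (i : ℕ)) ≠ 0 := by
  intro h
  have hc := congrArg (MvPolynomial.coeff
    (Finsupp.equivFunOnFinite.symm (fun j : Fin n => 2 * E - (j : ℕ)))) h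
  rw [Matrix.det_apply, MvPolynomial.coeff_sum] at hc
  simp only [Matrix.of_apply, MvPolynomial.coeff_smul, MvPolynomial.coeff_zero] at hc
  rw [Finset.sum_congr rfl (fun σ _ => by
    rw [coeff_prod_aux n (fun i => 2 * E - (σ i : ℕ)) (fun i => (σ i : ℕ)) _ (by
      intro i
      have h1 := (σ i).2
      have h2 := i.2
      simp only [Finsupp.equivFunOnFinite_symm_apply_apply]
      omega)])] at hc
  rw [Finset.sum_eq_single 1] at hc
  · simp at hc
  · intro σ _ hσ
    rw [if_neg]
    · simp
    · intro hh
      apply hσ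
      ext i
      have := hh i
      have h1 := (σ i).2
      have h2 := i.2
      simp only [Finsupp.equivFunOnFinite_symm_apply_apply] at this
      simp only [Equiv.Perm.one_apply]
      omega
  · intro h; simp at h

theorem Xv_ne (n : ℕ) (j : Fin n) : Xv n j ≠ 0 := by
  unfold Xv
  rw [Ne, FaithfulSMul.algebraMap_eq_zero_iff]
  exact MvPolynomial.X_ne_zero j

theorem spNum_ne (n e : ℕ) : spNum n (fun _ => (e : ℤ)) (Xv n) ≠ 0 := by
  intro h
  apply poly_det_ne n (e + n) (by omega)
  apply FaithfulSMul.algebraMap_injective (MvPolynomial (Fin n) ℚ) (FF n)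
  rw [map_zero, RingHom.map_det]
  have : (algebraMap (MvPolynomial (Fin n) ℚ) (FF n)).mapMatrix
      (Matrix.of fun i j : Fin n => (MvPolynomial.X j : MvPolynomial (Fin n) ℚ)
      ^ (2 * (e + n) - i) - MvPolynomial.X j ^ (i : ℕ)) =
      Matrix.of fun i j : Fin n => (Xv n j ^ (e + n)) * (Matrix.of fun i j : Fin n =>
        Xv n j ^ ((e : ℤ) + (n : ℤ) - ((i : ℕ) : ℤ))
          - Xv n j ^ (-((e : ℤ) + (n : ℤ) - ((i : ℕ) : ℤ)))) i j := by
    ext i j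
    have hi := i.2
    simp only [RingHom.mapMatrix_apply, Matrix.map_apply, Matrix.of_apply, map_sub, map_pow]
    change Xv n j ^ _ - Xv n j ^ _ = _
    rw [mul_sub, ← zpow_natCast, ← zpow_natCast, ← zpow_natCast, ← zpow_add₀ (Xv_ne n j),
      ← zpow_add₀ (Xv_ne n j)]
    congr 2 <;> omega
  rw [this, Matrix.det_mul_row]
  unfold spNum at h
  rw [h, mul_zero]

/-- `sp_{2n}((c^n)) · sp_{2n}((d^{n-p},(d-1)^p))
= ∑_{(c-d)^n ⊆ ν ⊆ ((c+d)^n), oddrows(ν/((c-d)^n)) = p} sp_{2n}(ν)`. -/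
theorem spWeyl_mul_spWeyl_nearly_rectangular_ge
    (n c d p : ℕ) (hpn : p ≤ n) (hdc : d ≤ c) (hd : 1 ≤ p → 1 ≤ d) :
    spWeyl n (fun _ : Fin n => (c : ℤ)) (Xv n) *
        spWeyl n (fun i : Fin n => if (i : ℕ) < n - p then (d : ℤ) else (d : ℤ) - 1) (Xv n)
      = ∑ ν ∈ ((Fintype.piFinset fun _ : Fin n => Finset.range (c + d + 1)).filter
            (fun ν => Antitone ν ∧ (∀ i, c - d ≤ ν i) ∧
              (Finset.univ.filter
                (fun i : Fin n => Odd ((ν i : ℤ) - ((c : ℤ) - (d : ℤ))))).card = p)),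
          spWeyl n (fun i => (ν i : ℤ)) (Xv n) := by
  have h0 : spNum n (fun _ => 0) (Xv n) ≠ 0 := by simpa using spNum_ne n 0
  have h := main_num n c (Xv n) (Xv_ne n) (spNum_ne n) d p hdc hpn hd
  simp only [spWeyl_eq]
  rw [← Finset.sum_div]
  change _ = GG n c d p (Xv n) / _
  rw [div_mul_div_comm, ← h, mul_div_mul_right _ _ h0]

end
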